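/- Let k ≥ 2 and let q be a prime power divisible by 3. Then the link of every vertex of the 3-partite 3-uniform hypergraph D_3(k,q) is isomorphic either to the bipartite graph D(k,q) or to the bipartite graph D'(k,q); moreover, the link of the zero vector in any part is isomorphic to D(k,q). -/

import Mathlib

open scoped Classical

namespace Paper

/-- `G` contains a copy of `F` (an injective graph homomorphism of `F` into `G`). -/
def HasGraphCopy {α β : Type*} (F : SimpleGraph α) (G : SimpleGraph β) : Prop :=
  ∃ f : α ↪ β, ∀ u v, F.Adj u v → G.Adj (f u) (f v)

/-- The 3-uniform hypergraph `H` contains a copy of the 3-uniform hypergraph `F`. -/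
def HasHypCopy {α β : Type*} (F : Set (Finset α)) (H : Set (Finset β)) : Prop :=
  ∃ f : α ↪ β, ∀ e ∈ F, e.map f ∈ H

/-- The suspension `Ĝ` of a graph `G`: a new vertex (`none`) joined to all vertices of `G`. -/
def suspension {α : Type*} (G : SimpleGraph α) : SimpleGraph (Option α) :=
  SimpleGraph.fromRel (fun x y => x = none ∨ ∃ u v, x = some u ∧ y = some v ∧ G.Adj u v)

/-- The hypergraph suspension `G̃` of a graph `G`: the triples `{x, u, v}` over edges `uv` of `G`,
where `x = none` is a new vertex. -/
def hypSuspension {α : Type*} (G : SimpleGraph α) : Set (Finset (Option α)) :=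
  {e | ∃ u v, G.Adj u v ∧ e = {none, some u, some v}}

/-- `ex(n, K₃, F)`: the maximum number of triangles in an `F`-free graph on `n` vertices. -/
noncomputable def exTriangles {α : Type*} (n : ℕ) (F : SimpleGraph α) : ℕ :=
  sSup {t | ∃ G : SimpleGraph (Fin n),
    ¬ HasGraphCopy F G ∧ t = {s : Finset (Fin n) | G.IsNClique 3 s}.ncard}

/-- `ex₃(n, F)`: the maximum number of triples in an `F`-free 3-uniform hypergraph on `n`
vertices. -/
noncomputable def ex3 {α : Type*} (n : ℕ) (F : Set (Finset α)) : ℕ :=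
  sSup {t | ∃ H : Finset (Finset (Fin n)), (∀ e ∈ H, e.card = 3) ∧
    ¬ HasHypCopy F (↑H : Set (Finset (Fin n))) ∧ t = H.card}

/-- `ex(n, C_m)`: the maximum number of edges in a graph on `n` vertices with no cycle of
length `m`. -/
noncomputable def exCycle (n m : ℕ) : ℕ :=
  sSup {t | ∃ G : SimpleGraph (Fin n),
    ¬ HasGraphCopy (SimpleGraph.cycleGraph m) G ∧ t = G.edgeSet.ncard}

/-- The link of a vertex `x` in a 3-uniform hypergraph `H`: `u ~ v` iff `{x, u, v} ∈ H`. -/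
def linkGraph {V : Type*} (H : Set (Finset V)) (x : V) : SimpleGraph V :=
  SimpleGraph.fromRel (fun u v => u ≠ x ∧ v ≠ x ∧ ({x, u, v} : Finset V) ∈ H)

/-!  Coordinates of a vector are labelled `x_1, x_{11}, x_{12}, x_{21}, x_{22}, x'_{22}, x_{23},
x_{32}, x_{33}, x'_{33}, x_{34}, x_{43}, …` and indexed `0, 1, 2, …`.  The `j`-th defining
equation (`j ≥ 1`) of the graph `D(q)` has the form `a_j + b_j + a_{aIdx j} * b_{bIdx j} = 0`. -/

/-- Index of the `a`-coordinate in the product term of the `j`-th equation. -/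
def aIdx : ℕ → ℕ
  | 1 => 0
  | 2 => 0
  | 3 => 1
  | j => if j % 4 = 0 ∨ j % 4 = 3 then j - 2 else 0

/-- Index of the `b`-coordinate in the product term of the `j`-th equation. -/
def bIdx : ℕ → ℕ
  | 1 => 0
  | 2 => 1
  | 3 => 0
  | j => if j % 4 = 0 ∨ j % 4 = 3 then 0 else j - 2

/-- Index of the extra linear term in the `j`-th equation of `D'(q)` (for `j ≥ 2`). -/
def linIdx : ℕ → ℕ
  | 2 => 1
  | j => j - 2

/-- Extend a vector in `F^k` to an `ℕ`-indexed sequence by zeros. -/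
def ext {k : ℕ} {F : Type*} [Zero F] (a : Fin k → F) (j : ℕ) : F :=
  if h : j < k then a ⟨j, h⟩ else 0

/-- The defining relation of the 3-graph `D₃(k,q)`: the first `k-1` equations. -/
def D3rel (k : ℕ) (F : Type*) [CommRing F] (a b c : Fin k → F) : Prop :=
  ∀ j : ℕ, 1 ≤ j → j < k →
    ext a j + ext b j + ext c j
      + ext a (aIdx j) * ext b (bIdx j)
      + ext b (aIdx j) * ext c (bIdx j)
      + ext c (aIdx j) * ext a (bIdx j) = 0

/-- The defining relation of the bipartite graph `D(k,q)`: the first `k-1` equations. -/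
def Drel (k : ℕ) (F : Type*) [CommRing F] (a b : Fin k → F) : Prop :=
  ∀ j : ℕ, 1 ≤ j → j < k →
    ext a j + ext b j + ext a (aIdx j) * ext b (bIdx j) = 0

/-- The defining relation of the bipartite graph `D'(k,q)`: the first `k-1` equations. -/
def D'rel (k : ℕ) (F : Type*) [CommRing F] (a b : Fin k → F) : Prop :=
  ∀ j : ℕ, 1 ≤ j → j < k →
    if j = 1 then
      ext a 1 - ext a 0 + ext b 1 - ext b 0 + ext a 0 * ext b 0 = 0
    else
      ext a j + ext a (linIdx j) + ext b j + ext b (linIdx j)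
        + ext a (aIdx j) * ext b (bIdx j) = 0

/-- The bipartite graph `D(k,q)` on two copies of `F^k`. -/
def DGraph (k : ℕ) (F : Type*) [CommRing F] :
    SimpleGraph ((Fin k → F) ⊕ (Fin k → F)) :=
  SimpleGraph.fromRel (fun x y => ∃ a b, x = Sum.inl a ∧ y = Sum.inr b ∧ Drel k F a b)

/-- The bipartite graph `D'(k,q)` on two copies of `F^k`. -/
def D'Graph (k : ℕ) (F : Type*) [CommRing F] :
    SimpleGraph ((Fin k → F) ⊕ (Fin k → F)) :=
  SimpleGraph.fromRel (fun x y => ∃ a b, x = Sum.inl a ∧ y = Sum.inr b ∧ D'rel k F a b)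

/-- `{a,b,c}`-membership for the link of a vertex `v` lying in part `p` of `D₃(k,q)`:
for `p = 0` (part `A`) the two remaining parts are `B, C`; for `p = 1` (part `B`) they are
`C, A`; for `p = 2` (part `C`) they are `A, B`. -/
def D3edgeProp (k : ℕ) (F : Type*) [CommRing F] (p : Fin 3) (v u w : Fin k → F) : Prop :=
  if p = 0 then D3rel k F v u w
  else if p = 1 then D3rel k F w v u
  else D3rel k F u w v

/-- The link of the vertex `v` in part `p` of the 3-partite 3-graph `D₃(k,q)`, as a bipartite
graph on the two remaining parts. -/
def linkD3 (k : ℕ) (F : Type*) [CommRing F] (p : Fin 3) (v : Fin k → F) :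
    SimpleGraph ((Fin k → F) ⊕ (Fin k → F)) :=
  SimpleGraph.fromRel
    (fun x y => ∃ u w, x = Sum.inl u ∧ y = Sum.inr w ∧ D3edgeProp k F p v u w)


lemma aIdx_eq (j : ℕ) : aIdx j = if j % 4 = 0 ∨ j % 4 = 3 then j - 2 else 0 := by
  unfold aIdx; split <;> simp

lemma bIdx_eq (j : ℕ) :
    bIdx j = if j = 2 then 1 else if j % 4 = 0 ∨ j % 4 = 3 then 0 else j - 2 := by
  unfold bIdx; split <;> simp_all

lemma linIdx_eq (j : ℕ) : linIdx j = if j = 2 then 1 else j - 2 := by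
  unfold linIdx; split <;> simp_all

lemma idx_cases {j : ℕ} (hj : 2 ≤ j) :
    (aIdx j = 0 ∧ bIdx j = linIdx j) ∨ (aIdx j = linIdx j ∧ bIdx j = 0) := by
  rw [aIdx_eq, bIdx_eq, linIdx_eq]; split_ifs <;> omega

lemma linIdx_lt {j : ℕ} (hj : 2 ≤ j) : linIdx j < j := by
  rw [linIdx_eq]; split_ifs <;> omega

lemma one_le_linIdx {j : ℕ} (hj : 2 ≤ j) : 1 ≤ linIdx j := by
  rw [linIdx_eq]; split_ifs <;> grind

lemma aIdx_eq_zero_iff {j : ℕ} (hj : 1 ≤ j) : aIdx j = 0 ↔ j % 4 = 1 ∨ j % 4 = 2 := by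
  rw [aIdx_eq]; split_ifs <;> omega

lemma bIdx_eq_zero_iff {j : ℕ} (hj : 1 ≤ j) :
    bIdx j = 0 ↔ j = 1 ∨ j % 4 = 0 ∨ j % 4 = 3 := by
  rw [bIdx_eq]; grind

/-- The indices of the coordinates that may occur in the correction of the `j`-th coordinate. -/
def corrIdx (j : ℕ) : Set ℕ :=
  {i | 1 ≤ i ∧ i < j ∧ (aIdx j = 0 → aIdx i = 0) ∧ (bIdx j = 0 → bIdx i = 0)}

lemma one_mem_corrIdx {j : ℕ} (hj : 2 ≤ j) : 1 ∈ corrIdx j :=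
  ⟨le_rfl, hj, fun _ => rfl, fun _ => rfl⟩

lemma exists_succ_of_aIdx {j : ℕ} (hj : 2 ≤ j) (ha : aIdx j = 0) {i : ℕ}
    (hi : i ∈ corrIdx (linIdx j)) :
    ∃ m ∈ corrIdx j, 2 ≤ m ∧ aIdx m = 0 ∧ bIdx m = i ∧ linIdx m = i := by
  obtain ⟨hi1, hij, hia, hib⟩ := hi
  have hl := one_le_linIdx hj
  rw [aIdx_eq_zero_iff hl, aIdx_eq_zero_iff hi1] at hia
  rw [bIdx_eq_zero_iff hl, bIdx_eq_zero_iff hi1] at hib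
  rw [aIdx_eq_zero_iff (by omega)] at ha
  have hlin : (j = 2 ∧ linIdx j = 1) ∨ linIdx j = j - 2 := by
    rw [linIdx_eq]; split_ifs <;> omega
  obtain ⟨m, hm⟩ : ∃ m, m = if i = 1 then 2 else i + 2 := ⟨_, rfl⟩
  have hm2 : 2 ≤ m := by split_ifs at hm <;> omega
  have hmj : m < j := by split_ifs at hm <;> omega
  have hma : aIdx m = 0 := by
    rw [aIdx_eq_zero_iff (by omega)]; split_ifs at hm <;> omega
  refine ⟨m, ⟨by omega, hmj, ?_, ?_⟩, hm2, hma, ?_, ?_⟩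
  · rw [aIdx_eq_zero_iff (by omega), aIdx_eq_zero_iff (by omega)]; split_ifs at hm <;> omega
  · rw [bIdx_eq_zero_iff (by omega), bIdx_eq_zero_iff (by omega)]; split_ifs at hm <;> omega
  · rw [bIdx_eq]; split_ifs at hm ⊢ <;> omega
  · rw [linIdx_eq]; split_ifs at hm ⊢ <;> omega

lemma exists_succ_of_bIdx {j : ℕ} (hj : 2 ≤ j) (hb : bIdx j = 0) {i : ℕ}
    (hi : i ∈ corrIdx (linIdx j)) :
    ∃ m ∈ corrIdx j, 2 ≤ m ∧ bIdx m = 0 ∧ aIdx m = i ∧ linIdx m = i := by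
  obtain ⟨hi1, hij, hia, hib⟩ := hi
  have hl := one_le_linIdx hj
  rw [aIdx_eq_zero_iff hl, aIdx_eq_zero_iff hi1] at hia
  rw [bIdx_eq_zero_iff hl, bIdx_eq_zero_iff hi1] at hib
  rw [bIdx_eq_zero_iff (by omega)] at hb
  have hlin : (j = 2 ∧ linIdx j = 1) ∨ linIdx j = j - 2 := by
    rw [linIdx_eq]; split_ifs <;> omega
  obtain ⟨m, hm⟩ : ∃ m, m = if i = 1 then 3 else i + 2 := ⟨_, rfl⟩
  have hm2 : 2 ≤ m := by split_ifs at hm <;> omega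
  have hmj : m < j := by split_ifs at hm <;> omega
  have hma : bIdx m = 0 := by
    rw [bIdx_eq_zero_iff (by omega)]; split_ifs at hm <;> omega
  refine ⟨m, ⟨by omega, hmj, ?_, ?_⟩, hm2, hma, ?_, ?_⟩
  · rw [aIdx_eq_zero_iff (by omega), aIdx_eq_zero_iff (by omega)]; split_ifs at hm <;> omega
  · rw [bIdx_eq_zero_iff (by omega), bIdx_eq_zero_iff (by omega)]; split_ifs at hm <;> omega
  · rw [aIdx_eq]; split_ifs at hm ⊢ <;> omega
  · rw [linIdx_eq]; split_ifs at hm ⊢ <;> omega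

section Corrections

variable {F : Type*} [Field F]

/-- Pairs of affine functionals on sequences whose coefficients at the positive indices agree and
are supported on `S`. -/
def corrections (F : Type*) [Field F] (S : Set ℕ) :
    Submodule F (((ℕ → F) → F) × ((ℕ → F) → F)) :=
  Submodule.span F
    ({p | ∃ i ∈ S, p = (fun x => x i, fun x => x i)} ∪
      {(fun x => x 0, 0), (0, fun x => x 0), (1, 0), (0, 1)})

lemma coord_mem_corrections {S : Set ℕ} {i : ℕ} (hi : i ∈ S) :
    ((fun x => x i, fun x => x i) : ((ℕ → F) → F) × ((ℕ → F) → F)) ∈ corrections F S :=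
  Submodule.subset_span (Or.inl ⟨i, hi, rfl⟩)

lemma fst_zero_mem_corrections (S : Set ℕ) :
    ((fun x => x 0, 0) : ((ℕ → F) → F) × ((ℕ → F) → F)) ∈ corrections F S :=
  Submodule.subset_span (by simp)

lemma snd_zero_mem_corrections (S : Set ℕ) :
    ((0, fun x => x 0) : ((ℕ → F) → F) × ((ℕ → F) → F)) ∈ corrections F S :=
  Submodule.subset_span (by simp)

lemma fst_one_mem_corrections (S : Set ℕ) :
    ((1, 0) : ((ℕ → F) → F) × ((ℕ → F) → F)) ∈ corrections F S :=
  Submodule.subset_span (by simp)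

lemma snd_one_mem_corrections (S : Set ℕ) :
    ((0, 1) : ((ℕ → F) → F) × ((ℕ → F) → F)) ∈ corrections F S :=
  Submodule.subset_span (by simp)

lemma corrections_induction {S : Set ℕ} {P : ((ℕ → F) → F) × ((ℕ → F) → F) → Prop}
    (coord : ∀ i ∈ S, P (fun x => x i, fun x => x i))
    (fst_zero : P (fun x => x 0, 0)) (snd_zero : P (0, fun x => x 0))
    (fst_one : P (1, 0)) (snd_one : P (0, 1)) (zero : P 0)
    (map_add : ∀ p q, P p → P q → P (p + q)) (map_smul : ∀ (c : F) p, P p → P (c • p))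
    {p : ((ℕ → F) → F) × ((ℕ → F) → F)} (hp : p ∈ corrections F S) : P p := by
  refine Submodule.span_induction ?_ zero (fun p q _ _ => map_add p q) (fun c p _ => map_smul c p) hp
  rintro q (⟨i, hi, rfl⟩ | hq)
  · exact coord i hi
  · simp only [Set.mem_insert_iff, Set.mem_singleton_iff] at hq
    rcases hq with rfl | rfl | rfl | rfl <;> assumption

lemma swap_mem_corrections {S : Set ℕ} {p : ((ℕ → F) → F) × ((ℕ → F) → F)}
    (hp : p ∈ corrections F S) : p.swap ∈ corrections F S := by
  refine corrections_induction (P := fun p => p.swap ∈ corrections F S)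
    (fun i hi => coord_mem_corrections hi) (snd_zero_mem_corrections S)
    (fst_zero_mem_corrections S) (snd_one_mem_corrections S) (fst_one_mem_corrections S)
    (Submodule.zero_mem _) (fun p q hp hq => ?_) (fun c p hp => ?_) hp
  · exact Submodule.add_mem _ hp hq
  · exact Submodule.smul_mem _ c hp

lemma corrections_congr {S : Set ℕ} {x y : ℕ → F} (h0 : x 0 = y 0) (h : ∀ i ∈ S, x i = y i)
    {p : ((ℕ → F) → F) × ((ℕ → F) → F)} (hp : p ∈ corrections F S) :
    p.1 x = p.1 y ∧ p.2 x = p.2 y := by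
  refine corrections_induction (P := fun p => p.1 x = p.1 y ∧ p.2 x = p.2 y)
    (fun i hi => ⟨h i hi, h i hi⟩) (by simp [h0]) (by simp [h0]) (by simp) (by simp)
    (by simp) (fun p q hp hq => ?_) (fun c p hp => ?_) hp
  · simp [hp, hq]
  · simp [hp]

lemma exists_next_linear (t : F) {S S' : Set ℕ} (h1 : 1 ∈ S') {σ : ℕ → ℕ}
    (hσ : ∀ i ∈ S, σ i ∈ S') {p : ((ℕ → F) → F) × ((ℕ → F) → F)} (hp : p ∈ corrections F S) :
    ∃ p' ∈ corrections F S', ∀ x y : ℕ → F,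
      x 1 + y 1 + x 0 * y 0 - t * (x 0 + y 0) = 0 →
      (∀ i ∈ S, x (σ i) + y (σ i) + x 0 * y i + t * (x i + y i) = 0) →
      p'.1 x + p'.2 y + x 0 * p.2 y + t * (p.1 x + p.2 y) = 0 := by
  refine corrections_induction (P := fun p => ∃ p' ∈ corrections F S', ∀ x y : ℕ → F,
      x 1 + y 1 + x 0 * y 0 - t * (x 0 + y 0) = 0 →
      (∀ i ∈ S, x (σ i) + y (σ i) + x 0 * y i + t * (x i + y i) = 0) →
      p'.1 x + p'.2 y + x 0 * p.2 y + t * (p.1 x + p.2 y) = 0)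
    (fun i hi => ?_) ?_ ?_ ?_ ?_ ?_ (fun p q hp hq => ?_) (fun c p hp => ?_) hp
  · exact ⟨_, coord_mem_corrections (hσ i hi), fun x y _ h => h i hi⟩
  · refine ⟨_, Submodule.smul_mem _ (-t) (fst_zero_mem_corrections S'), fun x y _ _ => ?_⟩
    simp
  · refine ⟨_, Submodule.add_mem _ (coord_mem_corrections h1) (Submodule.add_mem _
      (Submodule.smul_mem _ (-t) (fst_zero_mem_corrections S'))
      (Submodule.smul_mem _ (-(2 * t)) (snd_zero_mem_corrections S'))), fun x y h _ => ?_⟩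
    simp
    linear_combination h
  · refine ⟨_, Submodule.smul_mem _ (-t) (fst_one_mem_corrections S'), fun x y _ _ => ?_⟩
    simp
  · refine ⟨_, Submodule.add_mem _ (Submodule.smul_mem _ (-1) (fst_zero_mem_corrections S'))
      (Submodule.smul_mem _ (-t) (fst_one_mem_corrections S')), fun x y _ _ => ?_⟩
    simp
  · exact ⟨0, Submodule.zero_mem _, fun x y _ _ => by simp⟩
  · obtain ⟨p', hp', h⟩ := hp
    obtain ⟨q', hq', h'⟩ := hq
    refine ⟨_, Submodule.add_mem _ hp' hq', fun x y h₁ h₂ => ?_⟩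
    simp
    linear_combination h x y h₁ h₂ + h' x y h₁ h₂
  · obtain ⟨p', hp', h⟩ := hp
    refine ⟨_, Submodule.smul_mem _ c hp', fun x y h₁ h₂ => ?_⟩
    simp
    linear_combination c * h x y h₁ h₂

lemma exists_next (t v w : F) {S S' : Set ℕ} (h1 : 1 ∈ S') {σ : ℕ → ℕ}
    (hσ : ∀ i ∈ S, σ i ∈ S') {p : ((ℕ → F) → F) × ((ℕ → F) → F)} (hp : p ∈ corrections F S) :
    ∃ p' ∈ corrections F S', ∀ x y : ℕ → F,
      x 1 + y 1 + x 0 * y 0 - t * (x 0 + y 0) = 0 →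
      (∀ i ∈ S, x (σ i) + y (σ i) + x 0 * y i + t * (x i + y i) = 0) →
      p'.1 x + p'.2 y + x 0 * p.2 y + t * (p.1 x + p.2 y) + v * y 0 + w = 0 := by
  obtain ⟨p', hp', h⟩ := exists_next_linear t h1 hσ hp
  refine ⟨_, Submodule.add_mem _ hp' (Submodule.add_mem _
      (Submodule.smul_mem _ (-v) (snd_zero_mem_corrections S'))
      (Submodule.smul_mem _ (-w) (snd_one_mem_corrections S'))), fun x y h₁ h₂ => ?_⟩
  simp
  linear_combination h x y h₁ h₂

/-- The left-hand side of the `j`-th equation of the bipartite graph interpolating between `D`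
(for `t = 0`) and `D'` (for `t = 1`). -/
def twistedForm (t : F) (x y : ℕ → F) (j : ℕ) : F :=
  x j + y j + x (aIdx j) * y (bIdx j) +
    if j = 1 then -(t * (x 0 + y 0)) else t * (x (linIdx j) + y (linIdx j))

/-- The left-hand side of the `j`-th equation of `D₃`. -/
def tripleForm (x y z : ℕ → F) (j : ℕ) : F :=
  x j + y j + z j + x (aIdx j) * y (bIdx j) + y (aIdx j) * z (bIdx j) + z (aIdx j) * x (bIdx j)

/-- `q` corrects the `j`-th coordinate, given that `p` corrects the coordinate `linIdx j`. -/
def IsNext (v : ℕ → F) (j : ℕ) (p q : ((ℕ → F) → F) × ((ℕ → F) → F)) : Prop :=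
  q ∈ corrections F (corrIdx j) ∧ ∀ x y : ℕ → F,
    (∀ i, 1 ≤ i → i < j → twistedForm (v 0) x y i = 0) →
    q.1 x + q.2 y + v j + v 0 * (p.1 x + p.2 y) + v 0 * v (linIdx j) +
      (if aIdx j = 0 then x 0 * p.2 y + v (linIdx j) * y 0
        else p.1 x * y 0 + v (linIdx j) * x 0) = 0

lemma exists_isNext (v : ℕ → F) {j : ℕ} (hj : 2 ≤ j) {p : ((ℕ → F) → F) × ((ℕ → F) → F)}
    (hp : p ∈ corrections F (corrIdx (linIdx j))) : ∃ q, IsNext v j p q := by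
  by_cases ha : aIdx j = 0
  · have key := fun i (hi : i ∈ corrIdx (linIdx j)) => exists_succ_of_aIdx hj ha hi
    choose! σ hσ hσ2 hσa hσb hσl using key
    obtain ⟨q, hq, h⟩ :=
      exists_next (v 0) (v (linIdx j)) (v j + v 0 * v (linIdx j)) (one_mem_corrIdx hj) hσ hp
    refine ⟨q, hq, fun x y hxy => ?_⟩
    have h₁ := hxy 1 le_rfl hj
    have h₂ := h x y (by simp [twistedForm, aIdx, bIdx] at h₁; linear_combination h₁)
      (fun i hi => by
        have := hxy (σ i) (hσ i hi).1 (hσ i hi).2.1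
        rw [twistedForm, if_neg (by have := hσ2 i hi; omega), hσa i hi, hσb i hi, hσl i hi] at this
        exact this)
    rw [if_pos ha]
    linear_combination h₂
  · have hb : bIdx j = 0 := by
      rcases idx_cases hj with h | h
      · exact absurd h.1 ha
      · exact h.2
    have key := fun i (hi : i ∈ corrIdx (linIdx j)) => exists_succ_of_bIdx hj hb hi
    choose! σ hσ hσ2 hσb hσa hσl using key
    obtain ⟨q, hq, h⟩ := exists_next (v 0) (v (linIdx j)) (v j + v 0 * v (linIdx j))
      (one_mem_corrIdx hj) hσ (swap_mem_corrections hp)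
    refine ⟨q.swap, swap_mem_corrections hq, fun x y hxy => ?_⟩
    have h₁ := hxy 1 le_rfl hj
    have h₂ := h y x (by simp [twistedForm, aIdx, bIdx] at h₁; linear_combination h₁)
      (fun i hi => by
        have := hxy (σ i) (hσ i hi).1 (hσ i hi).2.1
        rw [twistedForm, if_neg (by have := hσ2 i hi; omega), hσa i hi, hσb i hi, hσl i hi] at this
        linear_combination this)
    rw [if_neg ha]
    simp only [Prod.fst_swap, Prod.snd_swap] at h₂ ⊢
    linear_combination h₂

/-- Recursion along `linIdx`. -/
def linRec {α : Type*} (p₀ p₁ : α) (next : ℕ → α → α) : ℕ → α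
  | 0 => p₀
  | 1 => p₁
  | n + 2 => next (n + 2) (linRec p₀ p₁ next (linIdx (n + 2)))
decreasing_by exact linIdx_lt (by omega)

lemma exists_correction_sequence (v : ℕ → F) :
    ∃ P : ℕ → ((ℕ → F) → F) × ((ℕ → F) → F),
      P 0 = (fun _ => v 0, fun _ => v 0) ∧ P 1 = (fun _ => 0, fun _ => -v 1) ∧
      (∀ j, P j ∈ corrections F (corrIdx j)) ∧
      ∀ j, 2 ≤ j → IsNext v j (P (linIdx j)) (P j) := by
  have key : ∀ (j : ℕ) (p : ((ℕ → F) → F) × ((ℕ → F) → F)), ∃ q,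
      2 ≤ j → p ∈ corrections F (corrIdx (linIdx j)) → IsNext v j p q := by
    intro j p
    by_cases h : 2 ≤ j ∧ p ∈ corrections F (corrIdx (linIdx j))
    · obtain ⟨q, hq⟩ := exists_isNext v h.1 h.2
      exact ⟨q, fun _ _ => hq⟩
    · exact ⟨p, fun h₁ h₂ => absurd ⟨h₁, h₂⟩ h⟩
  choose next hnext using key
  set P := linRec ((fun _ => v 0, fun _ => v 0) : ((ℕ → F) → F) × ((ℕ → F) → F))
    (fun _ => 0, fun _ => -v 1) next with hP
  have h0 : P 0 = (fun _ => v 0, fun _ => v 0) := by rw [hP, linRec]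
  have h1 : P 1 = (fun _ => 0, fun _ => -v 1) := by rw [hP, linRec]
  have h2 : ∀ j, 2 ≤ j → P j = next j (P (linIdx j)) := by
    intro j hj
    obtain ⟨n, rfl⟩ := Nat.exists_eq_add_of_le' hj
    rw [hP, linRec]
  have hmem : ∀ j, P j ∈ corrections F (corrIdx j) := by
    intro j
    induction j using Nat.strong_induction_on with
    | _ j ih =>
      rcases Nat.lt_or_ge j 2 with hj | hj
      · interval_cases j
        · rw [h0]
          convert Submodule.add_mem _
            (Submodule.smul_mem _ (v 0) (fst_one_mem_corrections (F := F) (corrIdx 0)))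
            (Submodule.smul_mem _ (v 0) (snd_one_mem_corrections (F := F) (corrIdx 0))) using 1
          ext <;> simp
        · rw [h1]
          convert Submodule.smul_mem _ (-v 1) (snd_one_mem_corrections (F := F) (corrIdx 1)) using 1
          ext <;> simp
      · rw [h2 j hj]
        exact (hnext j _ hj (ih _ (linIdx_lt hj))).1
  refine ⟨P, h0, h1, hmem, fun j hj => ?_⟩
  have := hnext j _ hj (hmem (linIdx j))
  rwa [← h2 j hj] at this

end Corrections

section Vectors

variable {k : ℕ} {F : Type*} [Field F]

lemma ext_apply_fin (a : Fin k → F) (j : Fin k) : ext a j = a j := by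
  simp [ext]

/-- The self-map of `F^k` adding the correction `f j` to the `j`-th coordinate. -/
def shear (f : ℕ → (ℕ → F) → F) (a : Fin k → F) : Fin k → F :=
  fun j => a j + f j (ext a)

lemma ext_shear (f : ℕ → (ℕ → F) → F) (a : Fin k → F) {j : ℕ} (hj : j < k) :
    ext (shear f a) j = ext a j + f j (ext a) := by
  simp [ext, shear, hj]

lemma shear_injective {f : ℕ → (ℕ → F) → F}
    (hf : ∀ j (x y : ℕ → F), (∀ i < j, x i = y i) → f j x = f j y) :
    Function.Injective (shear (k := k) f) := by
  intro a b hab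
  have key : ∀ j, j < k → ext a j = ext b j := by
    intro j
    induction j using Nat.strong_induction_on with
    | _ j ih =>
      intro hj
      have h := congrArg (fun c => ext c j) hab
      simp only [ext_shear f _ hj] at h
      rw [hf j _ _ fun i hi => ih i hi (hi.trans hj)] at h
      exact add_right_cancel h
  funext j
  rw [← ext_apply_fin a j, ← ext_apply_fin b j, key j j.2]

/-- The defining relation of the bipartite graph interpolating between `D` and `D'`. -/
def twistedRel (t : F) (a b : Fin k → F) : Prop :=
  ∀ j : ℕ, 1 ≤ j → j < k → twistedForm t (ext a) (ext b) j = 0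

lemma D3rel_rotate {a b c : Fin k → F} : D3rel k F a b c ↔ D3rel k F b c a := by
  unfold D3rel
  refine forall₃_congr fun j _ _ => ?_
  ring_nf

lemma D3edgeProp_iff (p : Fin 3) (v u w : Fin k → F) :
    D3edgeProp k F p v u w ↔ D3rel k F u w v := by
  unfold D3edgeProp
  split_ifs
  · exact D3rel_rotate
  · exact D3rel_rotate.trans D3rel_rotate
  · rfl

lemma tripleForm_eq_twistedForm (h3 : (3 : F) = 0) {v : Fin k → F}
    {P : ℕ → ((ℕ → F) → F) × ((ℕ → F) → F)}
    (h0 : P 0 = (fun _ => ext v 0, fun _ => ext v 0))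
    (h1 : P 1 = (fun _ => 0, fun _ => -ext v 1))
    (h2 : ∀ j, 2 ≤ j → IsNext (ext v) j (P (linIdx j)) (P j)) (a b : Fin k → F)
    {j : ℕ} (hj : 1 ≤ j) (hjk : j < k)
    (ih : ∀ i, 1 ≤ i → i < j → twistedForm (ext v 0) (ext a) (ext b) i = 0) :
    tripleForm (ext (shear (fun j => (P j).1) a)) (ext (shear (fun j => (P j).2) b)) (ext v) j
      = twistedForm (ext v 0) (ext a) (ext b) j := by
  have hk : 0 < k := by omega
  rcases hj.eq_or_lt with rfl | hj2
  · simp [tripleForm, twistedForm, aIdx, bIdx, ext_shear, hk, hjk, h0, h1]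
    linear_combination (ext v 0 * (ext a 0 + ext b 0) + ext v 0 ^ 2) * h3
  · have hl := (linIdx_lt hj2).trans hjk
    have h := (h2 j hj2).2 (ext a) (ext b) ih
    have hj1 : j ≠ 1 := by omega
    rw [tripleForm, twistedForm, if_neg hj1]
    by_cases ha : aIdx j = 0
    · have hb : bIdx j = linIdx j := by
        rcases idx_cases hj2 with h | h
        · exact h.2
        · have : linIdx j = 0 := h.1.symm.trans ha
          rw [h.2, this]
      rw [if_pos ha] at h
      rw [ha, hb]
      simp only [ext_shear, hk, hjk, hl, h0]
      linear_combination h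
    · obtain ⟨ha', hb⟩ := (idx_cases hj2).resolve_left fun h => ha h.1
      rw [if_neg ha] at h
      rw [ha', hb]
      simp only [ext_shear, hk, hjk, hl, h0]
      linear_combination h

lemma forall_eq_zero_iff {e m : ℕ → F}
    (h : ∀ j, 1 ≤ j → j < k → (∀ i, 1 ≤ i → i < j → e i = 0) → m j = e j) :
    (∀ j, 1 ≤ j → j < k → m j = 0) ↔ ∀ j, 1 ≤ j → j < k → e j = 0 := by
  constructor
  · intro hm j
    induction j using Nat.strong_induction_on with
    | _ j ih =>
      intro hj hjk
      rw [← h j hj hjk fun i hi hij => ih i hij hi (hij.trans hjk)]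
      exact hm j hj hjk
  · intro he j hj hjk
    rw [h j hj hjk fun i hi hij => he i hi (hij.trans hjk)]
    exact he j hj hjk

lemma exists_equiv_D3rel_iff_twistedRel [Finite F] (h3 : (3 : F) = 0) (v : Fin k → F) :
    ∃ e₁ e₂ : (Fin k → F) ≃ (Fin k → F),
      ∀ a b, D3rel k F (e₁ a) (e₂ b) v ↔ twistedRel (ext v 0) a b := by
  obtain ⟨P, h0, h1, hmem, h2⟩ := exists_correction_sequence (ext v)
  have hloc : ∀ j (x y : ℕ → F), (∀ i < j, x i = y i) →
      (P j).1 x = (P j).1 y ∧ (P j).2 x = (P j).2 y := by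
    intro j x y hxy
    rcases Nat.eq_zero_or_pos j with rfl | hj
    · simp [h0]
    · exact corrections_congr (hxy 0 hj) (fun i hi => hxy i hi.2.1) (hmem j)
  have hb₁ := Finite.injective_iff_bijective.1
    (shear_injective (k := k) fun j x y h => (hloc j x y h).1)
  have hb₂ := Finite.injective_iff_bijective.1
    (shear_injective (k := k) fun j x y h => (hloc j x y h).2)
  refine ⟨Equiv.ofBijective _ hb₁, Equiv.ofBijective _ hb₂, fun a b => ?_⟩
  exact forall_eq_zero_iff fun j hj hjk ih => tripleForm_eq_twistedForm h3 h0 h1 h2 a b hj hjk ih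

lemma twistedRel_zero_iff (a b : Fin k → F) : twistedRel 0 a b ↔ Drel k F a b := by
  simp [twistedRel, Drel, twistedForm]

lemma twistedRel_one_iff (a b : Fin k → F) : twistedRel 1 a b ↔ D'rel k F a b := by
  refine forall₃_congr fun j _ _ => ?_
  rw [twistedForm]
  split_ifs with h
  · subst h
    simp only [aIdx, bIdx]
    ring_nf
  · ring_nf

/-- The weight of the `j`-th coordinate for which the equations of `D` are homogeneous. -/
def weight (j : ℕ) : ℕ := if j = 0 then 1 else j / 2 + 2

lemma weight_aIdx_add_weight_bIdx {j : ℕ} (hj : 1 ≤ j) :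
    weight (aIdx j) + weight (bIdx j) = weight j := by
  simp only [weight, aIdx_eq, bIdx_eq]; grind

lemma weight_linIdx_add_one {j : ℕ} (hj : 2 ≤ j) : weight (linIdx j) + 1 = weight j := by
  simp only [weight, linIdx_eq]; grind

/-- Weighted scaling of `F^k` by a nonzero scalar. -/
def weightedScale {t : F} (ht : t ≠ 0) : (Fin k → F) ≃ (Fin k → F) :=
  Equiv.piCongrRight fun j => Equiv.mulLeft₀ (t ^ weight j) (pow_ne_zero _ ht)

lemma ext_weightedScale {t : F} (ht : t ≠ 0) (a : Fin k → F) (j : ℕ) :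
    ext (weightedScale ht a) j = t ^ weight j * ext a j := by
  unfold ext weightedScale
  split_ifs <;> simp

lemma twistedRel_weightedScale_iff {t : F} (ht : t ≠ 0) (a b : Fin k → F) :
    twistedRel t (weightedScale ht a) (weightedScale ht b) ↔ twistedRel 1 a b := by
  refine forall₃_congr fun j hj _ => ?_
  have key : twistedForm t (ext (weightedScale ht a)) (ext (weightedScale ht b)) j
      = t ^ weight j * twistedForm 1 (ext a) (ext b) j := by
    simp only [twistedForm, ext_weightedScale]
    rcases hj.eq_or_lt with rfl | hj2
    · simp [weight, aIdx, bIdx]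
      ring
    · have hj1 : j ≠ 1 := by omega
      rw [if_neg hj1, if_neg hj1]
      have hw := congrArg (t ^ ·) (weight_aIdx_add_weight_bIdx hj)
      have hl := congrArg (t ^ ·) (weight_linIdx_add_one hj2)
      simp only [pow_add, pow_one] at hw hl
      linear_combination ext a (aIdx j) * ext b (bIdx j) * hw
        + (ext a (linIdx j) + ext b (linIdx j)) * hl
  rw [key, mul_eq_zero, or_iff_right (pow_ne_zero _ ht)]

end Vectors

lemma nonempty_iso_fromRel_sum {α β α' β' : Type*} {R : α → β → Prop} {R' : α' → β' → Prop}
    (e₁ : α' ≃ α) (e₂ : β' ≃ β) (h : ∀ a b, R (e₁ a) (e₂ b) ↔ R' a b) :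
    Nonempty
      (SimpleGraph.fromRel (fun x y : α ⊕ β => ∃ a b, x = Sum.inl a ∧ y = Sum.inr b ∧ R a b) ≃g
        SimpleGraph.fromRel
          (fun x y : α' ⊕ β' => ∃ a b, x = Sum.inl a ∧ y = Sum.inr b ∧ R' a b)) := by
  refine ⟨RelIso.symm ⟨Equiv.sumCongr e₁ e₂, ?_⟩⟩
  rintro (a | a) (b | b) <;> simp [SimpleGraph.fromRel_adj, h]

lemma three_eq_zero_of_dvd_card {F : Type*} [Field F] [Fintype F] (hq : 3 ∣ Fintype.card F) :
    (3 : F) = 0 := by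
  have : Fact (Nat.Prime 3) := ⟨Nat.prime_three⟩
  obtain ⟨x, hx⟩ := exists_prime_addOrderOf_dvd_card 3 hq
  have h : (3 : F) * x = 0 := by simpa [hx] using addOrderOf_nsmul_eq_zero x
  refine (mul_eq_zero.1 h).resolve_right fun h0 => ?_
  simp [h0] at hx

lemma nonempty_linkD3_iso {k : ℕ} {F : Type*} [Field F] [Finite F] (h3 : (3 : F) = 0)
    (p : Fin 3) (v : Fin k → F) :
    (ext v 0 = 0 → Nonempty (linkD3 k F p v ≃g DGraph k F)) ∧
    (ext v 0 ≠ 0 → Nonempty (linkD3 k F p v ≃g D'Graph k F)) := by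
  obtain ⟨e₁, e₂, he⟩ := exists_equiv_D3rel_iff_twistedRel h3 v
  constructor
  · intro h0
    refine nonempty_iso_fromRel_sum e₁ e₂ fun a b => ?_
    rw [D3edgeProp_iff, he, h0, twistedRel_zero_iff]
  · intro h0
    refine nonempty_iso_fromRel_sum ((weightedScale h0).trans e₁) ((weightedScale h0).trans e₂)
      fun a b => ?_
    rw [D3edgeProp_iff, Equiv.trans_apply, Equiv.trans_apply, he, twistedRel_weightedScale_iff,
      twistedRel_one_iff]

/-- For `k ≥ 2` and a prime power `q` divisible by 3, the link of every vertex
of `D₃(k,q)` is isomorphic to `D(k,q)` or to `D'(k,q)`; and the link of the zero vector in any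
part is isomorphic to `D(k,q)`. -/
theorem D3_two_links (k : ℕ) (hk : 2 ≤ k) (F : Type) [Field F] [Fintype F]
    (hq : 3 ∣ Fintype.card F) :
    (∀ (p : Fin 3) (v : Fin k → F),
      Nonempty (linkD3 k F p v ≃g DGraph k F) ∨
      Nonempty (linkD3 k F p v ≃g D'Graph k F)) ∧
    (∀ p : Fin 3, Nonempty (linkD3 k F p (0 : Fin k → F) ≃g DGraph k F)) := by
  have h3 : (3 : F) = 0 := three_eq_zero_of_dvd_card hq
  refine ⟨fun p v => ?_, fun p => (nonempty_linkD3_iso h3 p 0).1 (by simp [ext])⟩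
  by_cases h0 : ext v 0 = 0
  · exact Or.inl ((nonempty_linkD3_iso h3 p v).1 h0)
  · exact Or.inr ((nonempty_linkD3_iso h3 p v).2 h0)

end Paper
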